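/- Under the standing assumptions, for every n ≥ 0 the map Φ intertwines the cyclic operator τ_{A#_σH} of the cyclic module of the algebra A#_σH with the diagonal cyclic operator t∘τ: (t∘τ)∘Φ = Φ∘τ_{A#_σH} as maps (A#_σH)^{⊗(n+1)} → H^{⊗(n+1)}⊗A^{⊗(n+1)}, where τ_{A#_σH}(x_0⊗⋯⊗x_n) = x_n⊗x_0⊗⋯⊗x_{n−1}, τ(g_0,…,g_n | a_0,…,a_n) = (g_0⁽²⁾,…,g_n⁽²⁾ | S(g_0⁽¹⁾⋯g_n⁽¹⁾)(a_n), a_0,…,a_{n−1}), and t(g_0,…,g_n | a_0,…,a_n) = (g_n^{(n+2)}, g_0,…,g_{n−1} | g_n⁽¹⁾(a_0),…,g_n^{(n+1)}(a_n)). -/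

import Mathlib

open TensorProduct

noncomputable section

/-! ## Tensor powers, iterated comultiplication and Sweedler representations -/

/-- `Tpow k V n` is the `(n+1)`-fold tensor power `V ⊗ V ⊗ ⋯ ⊗ V` (`n+1` factors),
bundled as an object of `ModuleCat k`. -/
def Tpow (k : Type) [Field k] (V : Type) [AddCommGroup V] [Module k V] : ℕ → ModuleCat k
  | 0 => ModuleCat.of k V
  | n + 1 => ModuleCat.of k (V ⊗[k] (Tpow k V n))

/-- The elementary tensor `f 0 ⊗ f 1 ⊗ ⋯ ⊗ f n` in `Tpow k V n`. -/
def tpow (k : Type) [Field k] (V : Type) [AddCommGroup V] [Module k V] :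
    (n : ℕ) → (Fin (n + 1) → V) → Tpow k V n
  | 0, f => (f 0 : V)
  | n + 1, f => (f 0 ⊗ₜ[k] tpow k V n (fun i => f i.succ) : V ⊗[k] Tpow k V n)

/-- The iterated comultiplication `Δ⁽ⁿ⁾ : H → H^{⊗(n+1)}`, `Δ⁽⁰⁾ = id`,
`Δ⁽ⁿ⁺¹⁾ = (1 ⊗ Δ⁽ⁿ⁾) ∘ Δ`. -/
def comulIter (k : Type) [Field k] (H : Type) [Ring H] [HopfAlgebra k H] :
    (n : ℕ) → H →ₗ[k] Tpow k H n
  | 0 => LinearMap.id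
  | n + 1 =>
    (LinearMap.lTensor H (comulIter k H n) ∘ₗ Coalgebra.comul :
      H →ₗ[k] (H ⊗[k] Tpow k H n))

/-- A finite Sweedler-type representation `Δ⁽ⁿ⁾ h = ∑ᵢ h⁽¹⁾ᵢ ⊗ ⋯ ⊗ h⁽ⁿ⁺¹⁾ᵢ` of the iterated
comultiplication of `h`; `leg i j` is the `(j+1)`-st Sweedler leg of the `i`-th summand. -/
structure IterRepr (k : Type) [Field k] (H : Type) [Ring H] [HopfAlgebra k H]
    (n : ℕ) (h : H) where
  ι : Type
  s : Finset ι
  leg : ι → Fin (n + 1) → H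
  eq : ∑ i ∈ s, tpow k H n (leg i) = comulIter k H n h

/-- Merge an `(n+1)`-tuple to an `n`-tuple, replacing the two entries at positions `i, i+1`
by the single entry `v`. -/
def mergeAt {V : Type} {n : ℕ} (i : Fin n) (x : Fin (n + 1) → V) (v : V) :
    Fin n → V :=
  fun j => if (j : ℕ) < (i : ℕ) then x (Fin.castSucc j) else
    if (j : ℕ) = (i : ℕ) then v else x j.succ

variable (k : Type) [Field k] (H : Type) [Ring H] [HopfAlgebra k H]

/-- `H` is cocommutative. -/
def Cocomm : Prop :=
  ∀ h : H, (TensorProduct.comm k H H) (Coalgebra.comul (R := k) h) = Coalgebra.comul (R := k) h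

variable (A : Type) [Ring A] [Algebra k A]
variable (rho : H →ₗ[k] A →ₗ[k] A)

/-- `rho` is a weak action of `H` on `A`:
`h(ab) = h⁽¹⁾(a)h⁽²⁾(b)`, `h(1) = ε(h)1` and `1(a) = a`. -/
def IsWeakAction : Prop :=
  (∀ (h : H) (a b : A) (R : IterRepr k H 1 h),
      rho h (a * b) = ∑ i ∈ R.s, rho (R.leg i 0) a * rho (R.leg i 1) b) ∧
  (∀ h : H, rho h (1 : A) = Coalgebra.counit (R := k) h • (1 : A)) ∧
  (∀ a : A, rho 1 a = a)

/-- `rho` makes `A` a left `H`-module algebra: a weak action which is an action. -/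
def IsModuleAlgebraAction : Prop :=
  IsWeakAction k H A rho ∧ (∀ (h l : H) (a : A), rho (h * l) a = rho h (rho l a))

variable (sg : H →ₗ[k] H →ₗ[k] k)

/-- Normality for a `k`-valued cocycle: `σ(h,1) = σ(1,h) = ε(h)`. -/
def NormalK : Prop :=
  ∀ h : H, sg h 1 = Coalgebra.counit (R := k) h ∧ sg 1 h = Coalgebra.counit (R := k) h

/-- The cocycle property for a `k`-valued cocycle:
`σ(l⁽¹⁾,m⁽¹⁾)σ(h,l⁽²⁾m⁽²⁾) = σ(h⁽¹⁾,l⁽¹⁾)σ(h⁽²⁾l⁽²⁾,m)`. -/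
def CocycleK : Prop :=
  ∀ (h l m : H) (Rh : IterRepr k H 1 h) (Rl : IterRepr k H 1 l) (Rm : IterRepr k H 1 m),
    ∑ j ∈ Rl.s, ∑ c ∈ Rm.s,
        sg (Rl.leg j 0) (Rm.leg c 0) * sg h (Rl.leg j 1 * Rm.leg c 1) =
      ∑ i ∈ Rh.s, ∑ j ∈ Rl.s,
        sg (Rh.leg i 0) (Rl.leg j 0) * sg (Rh.leg i 1 * Rl.leg j 1) m

/-- The twisted module property for a `k`-valued cocycle:
`h⁽¹⁾(l⁽¹⁾(a))σ(h⁽²⁾,l⁽²⁾) = σ(h⁽¹⁾,l⁽¹⁾)(h⁽²⁾l⁽²⁾)(a)`. -/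
def TwistedModuleK : Prop :=
  ∀ (h l : H) (a : A) (Rh : IterRepr k H 1 h) (Rl : IterRepr k H 1 l),
    ∑ i ∈ Rh.s, ∑ j ∈ Rl.s,
        sg (Rh.leg i 1) (Rl.leg j 1) • rho (Rh.leg i 0) (rho (Rl.leg j 0) a) =
      ∑ i ∈ Rh.s, ∑ j ∈ Rl.s,
        sg (Rh.leg i 0) (Rl.leg j 0) • rho (Rh.leg i 1 * Rl.leg j 1) a

/-- The `k`-valued map `σ`, viewed in the convolution algebra `Hom_k(H ⊗ H, A)` via
`x ⊗ y ↦ σ(x,y)1_A`, is convolution invertible. -/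
def ConvInvertibleK : Prop :=
  ∃ sg' : H →ₗ[k] H →ₗ[k] A,
    ∀ (h l : H) (Rh : IterRepr k H 1 h) (Rl : IterRepr k H 1 l),
      (∑ i ∈ Rh.s, ∑ j ∈ Rl.s,
          (sg (Rh.leg i 0) (Rl.leg j 0) • (1 : A)) * sg' (Rh.leg i 1) (Rl.leg j 1) =
        (Coalgebra.counit (R := k) h * Coalgebra.counit (R := k) l) • (1 : A)) ∧
      (∑ i ∈ Rh.s, ∑ j ∈ Rl.s,
          sg' (Rh.leg i 0) (Rl.leg j 0) * (sg (Rh.leg i 1) (Rl.leg j 1) • (1 : A)) =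
        (Coalgebra.counit (R := k) h * Coalgebra.counit (R := k) l) • (1 : A))

/-- Normality, as an identity in `A`: `σ(h,1) = σ(1,h) = ε(h)1_A`. -/
def NormalKA : Prop :=
  ∀ h : H, sg h 1 • (1 : A) = Coalgebra.counit (R := k) h • (1 : A) ∧
    sg 1 h • (1 : A) = Coalgebra.counit (R := k) h • (1 : A)

/-- The cocycle property, as an identity in `A` (values of `σ` lie in `k·1_A`):
`σ(l⁽¹⁾,m⁽¹⁾)σ(h,l⁽²⁾m⁽²⁾) = σ(h⁽¹⁾,l⁽¹⁾)σ(h⁽²⁾l⁽²⁾,m)`. -/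
def CocycleKA : Prop :=
  ∀ (h l m : H) (Rh : IterRepr k H 1 h) (Rl : IterRepr k H 1 l) (Rm : IterRepr k H 1 m),
    ∑ j ∈ Rl.s, ∑ c ∈ Rm.s,
        (sg (Rl.leg j 0) (Rm.leg c 0) * sg h (Rl.leg j 1 * Rm.leg c 1)) • (1 : A) =
      ∑ i ∈ Rh.s, ∑ j ∈ Rl.s,
        (sg (Rh.leg i 0) (Rl.leg j 0) * sg (Rh.leg i 1 * Rl.leg j 1) m) • (1 : A)

/-! ## The operators of the cylindrical module `A ♮_σ H` -/

/-- Spec of the horizontal face `dᵢ` (`0 ≤ i < P`) on `H^{⊗(P+1)} ⊗ A^{⊗(q+1)}`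
(here `P = p+1`):
`dᵢ(g₀,…,g_P | a₀,…,a_q) = (g₀,…,gᵢ⁽¹⁾g_{i+1}⁽¹⁾,…,g_P | σ(gᵢ⁽²⁾,g_{i+1}⁽²⁾)a₀, a₁,…,a_q)`. -/
def IsHorFace (p q : ℕ) (i : Fin (p + 1))
    (D : ((Tpow k H (p + 1) : Type) ⊗[k] (Tpow k A q : Type)) →ₗ[k]
      ((Tpow k H p : Type) ⊗[k] (Tpow k A q : Type))) : Prop :=
  ∀ (g : Fin (p + 2) → H) (a : Fin (q + 1) → A)
    (R : IterRepr k H 1 (g i.castSucc)) (S : IterRepr k H 1 (g i.succ)),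
    D (tpow k H (p + 1) g ⊗ₜ[k] tpow k A q a) =
      ∑ r ∈ R.s, ∑ s ∈ S.s,
        tpow k H p (mergeAt i g (R.leg r 0 * S.leg s 0)) ⊗ₜ[k]
          tpow k A q (Function.update a 0 (sg (R.leg r 1) (S.leg s 1) • a 0))

/-- Spec of the last horizontal face `d_P` on `H^{⊗(P+1)} ⊗ A^{⊗(q+1)}` (here `P = p+1`):
`d_P(g₀,…,g_P | a₀,…,a_q) = (g_P^{(q+2)}g₀⁽¹⁾, g₁,…,g_{P−1} |
σ(g_P^{(q+3)},g₀⁽²⁾)g_P⁽¹⁾(a₀), g_P⁽²⁾(a₁),…,g_P^{(q+1)}(a_q))`. -/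
def IsLastHorFace (p q : ℕ)
    (D : ((Tpow k H (p + 1) : Type) ⊗[k] (Tpow k A q : Type)) →ₗ[k]
      ((Tpow k H p : Type) ⊗[k] (Tpow k A q : Type))) : Prop :=
  ∀ (g : Fin (p + 2) → H) (a : Fin (q + 1) → A)
    (R : IterRepr k H (q + 2) (g (Fin.last (p + 1)))) (S : IterRepr k H 1 (g 0)),
    D (tpow k H (p + 1) g ⊗ₜ[k] tpow k A q a) =
      ∑ r ∈ R.s, ∑ s ∈ S.s,
        tpow k H p
          (Fin.cases (R.leg r ⟨q + 1, by omega⟩ * S.leg s 0)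
            (fun j : Fin p => g j.succ.castSucc)) ⊗ₜ[k]
        tpow k A q (fun c : Fin (q + 1) =>
          if c = 0 then
            sg (R.leg r ⟨q + 2, by omega⟩) (S.leg s 1) • rho (R.leg r 0) (a 0)
          else rho (R.leg r (Fin.castLE (by omega) c)) (a c))

/-- Spec of the horizontal cyclic operator `t` on `H^{⊗(p+1)} ⊗ A^{⊗(q+1)}`:
`t(g₀,…,g_p | a₀,…,a_q) = (g_p^{(q+2)}, g₀,…,g_{p−1} | g_p⁽¹⁾(a₀),…,g_p^{(q+1)}(a_q))`. -/
def IsCycT (p q : ℕ)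
    (T : ((Tpow k H p : Type) ⊗[k] (Tpow k A q : Type)) →ₗ[k]
      ((Tpow k H p : Type) ⊗[k] (Tpow k A q : Type))) : Prop :=
  ∀ (g : Fin (p + 1) → H) (a : Fin (q + 1) → A)
    (R : IterRepr k H (q + 1) (g (Fin.last p))),
    T (tpow k H p g ⊗ₜ[k] tpow k A q a) =
      ∑ r ∈ R.s,
        tpow k H p (Fin.cases (R.leg r (Fin.last (q + 1))) (fun j : Fin p => g j.castSucc))
          ⊗ₜ[k]
        tpow k A q (fun c : Fin (q + 1) => rho (R.leg r c.castSucc) (a c))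

/-- Spec of the vertical cyclic operator `τ` on `H^{⊗(p+1)} ⊗ A^{⊗(q+1)}`:
`τ(g₀,…,g_p | a₀,…,a_q) = (g₀⁽²⁾,…,g_p⁽²⁾ | S(g₀⁽¹⁾⋯g_p⁽¹⁾)(a_q), a₀,…,a_{q−1})`. -/
def IsCycTau (p q : ℕ)
    (T : ((Tpow k H p : Type) ⊗[k] (Tpow k A q : Type)) →ₗ[k]
      ((Tpow k H p : Type) ⊗[k] (Tpow k A q : Type))) : Prop :=
  ∀ (g : Fin (p + 1) → H) (a : Fin (q + 1) → A)
    (R : ∀ i : Fin (p + 1), IterRepr k H 1 (g i)),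
    T (tpow k H p g ⊗ₜ[k] tpow k A q a) =
      ∑ e ∈ Fintype.piFinset (fun i => (R i).s),
        tpow k H p (fun i => (R i).leg (e i) 1) ⊗ₜ[k]
        tpow k A q
          (Fin.cases
            (rho (HopfAlgebra.antipode (R := k)
                ((List.ofFn (fun i : Fin (p + 1) => (R i).leg (e i) 0)).prod))
              (a (Fin.last q)))
            (fun c : Fin q => a c.castSucc))

/-- Spec of the vertical face `δᵢ` (`0 ≤ i < Q`) on `H^{⊗(p+1)} ⊗ A^{⊗(Q+1)}`
(here `Q = q+1`): `δᵢ(g | a₀,…,a_Q) = (g | a₀,…,aᵢa_{i+1},…,a_Q)`. -/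
def IsVerFace (p q : ℕ) (i : Fin (q + 1))
    (D : ((Tpow k H p : Type) ⊗[k] (Tpow k A (q + 1) : Type)) →ₗ[k]
      ((Tpow k H p : Type) ⊗[k] (Tpow k A q : Type))) : Prop :=
  ∀ (g : Fin (p + 1) → H) (a : Fin (q + 2) → A),
    D (tpow k H p g ⊗ₜ[k] tpow k A (q + 1) a) =
      tpow k H p g ⊗ₜ[k] tpow k A q (mergeAt i a (a i.castSucc * a i.succ))

/-- Spec of the last vertical face `δ_Q` on `H^{⊗(p+1)} ⊗ A^{⊗(Q+1)}` (here `Q = q+1`):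
`δ_Q(g₀,…,g_p | a₀,…,a_Q) = (g₀⁽²⁾,…,g_p⁽²⁾ | S(g₀⁽¹⁾⋯g_p⁽¹⁾)(a_Q)a₀, a₁,…,a_{Q−1})`. -/
def IsLastVerFace (p q : ℕ)
    (D : ((Tpow k H p : Type) ⊗[k] (Tpow k A (q + 1) : Type)) →ₗ[k]
      ((Tpow k H p : Type) ⊗[k] (Tpow k A q : Type))) : Prop :=
  ∀ (g : Fin (p + 1) → H) (a : Fin (q + 2) → A)
    (R : ∀ i : Fin (p + 1), IterRepr k H 1 (g i)),
    D (tpow k H p g ⊗ₜ[k] tpow k A (q + 1) a) =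
      ∑ e ∈ Fintype.piFinset (fun i => (R i).s),
        tpow k H p (fun i => (R i).leg (e i) 1) ⊗ₜ[k]
        tpow k A q
          (Fin.cases
            (rho (HopfAlgebra.antipode (R := k)
                ((List.ofFn (fun i : Fin (p + 1) => (R i).leg (e i) 0)).prod))
              (a (Fin.last (q + 1))) * a 0)
            (fun c : Fin q => a c.succ.castSucc))

/-! ## The crossed product `A #_σ H`, its cyclic module, and the maps `Φ`, `Ψ` -/

/-- Spec of the multiplication of the crossed product `A #_σ H` on `A ⊗ H`:
`(a ⊗ h)(b ⊗ l) = a h⁽¹⁾(b) σ(h⁽²⁾,l⁽¹⁾) ⊗ h⁽³⁾l⁽²⁾`. -/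
def IsCrossedMul (mul : (A ⊗[k] H) →ₗ[k] (A ⊗[k] H) →ₗ[k] (A ⊗[k] H)) : Prop :=
  ∀ (a b : A) (h l : H) (R : IterRepr k H 2 h) (S : IterRepr k H 1 l),
    mul (a ⊗ₜ[k] h) (b ⊗ₜ[k] l) =
      ∑ i ∈ R.s, ∑ j ∈ S.s,
        (sg (R.leg i 1) (S.leg j 0) • (a * rho (R.leg i 0) b)) ⊗ₜ[k]
          (R.leg i 2 * S.leg j 1)

/-- Spec of the map `Φ : (A #_σ H)^{⊗(n+1)} → H^{⊗(n+1)} ⊗ A^{⊗(n+1)}`: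
`Φ(a₀ ⊗ g₀,…,aₙ ⊗ gₙ) = (g₀⁽²⁾, g₁⁽³⁾,…,gₙ⁽ⁿ⁺²⁾ | S(g₀⁽¹⁾g₁⁽²⁾⋯gₙ⁽ⁿ⁺¹⁾)(a₀),…,S(gₙ⁽¹⁾)(aₙ))`. -/
def IsPhi (n : ℕ)
    (Phi : (Tpow k (A ⊗[k] H) n : Type) →ₗ[k]
      ((Tpow k H n : Type) ⊗[k] (Tpow k A n : Type))) : Prop :=
  ∀ (a : Fin (n + 1) → A) (g : Fin (n + 1) → H)
    (R : ∀ i : Fin (n + 1), IterRepr k H ((i : ℕ) + 1) (g i)),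
    Phi (tpow k (A ⊗[k] H) n (fun i => a i ⊗ₜ[k] g i)) =
      ∑ e ∈ Fintype.piFinset (fun i => (R i).s),
        tpow k H n (fun i => (R i).leg (e i) (Fin.last ((i : ℕ) + 1))) ⊗ₜ[k]
        tpow k A n (fun i =>
          rho (HopfAlgebra.antipode (R := k)
              ((List.ofFn (fun m : Fin (n + 1 - (i : ℕ)) =>
                (R ⟨(i : ℕ) + (m : ℕ), by have := m.isLt; have := i.isLt; omega⟩).leg
                  (e ⟨(i : ℕ) + (m : ℕ), by have := m.isLt; have := i.isLt; omega⟩)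
                  ⟨(m : ℕ), by have := m.isLt; have := i.isLt; simp; omega⟩)).prod))
            (a i))

/-- Spec of the map `Ψ : H^{⊗(n+1)} ⊗ A^{⊗(n+1)} → (A #_σ H)^{⊗(n+1)}`:
`Ψ(g₀,…,gₙ | a₀,…,aₙ) = ((g₀⁽¹⁾⋯gₙ⁽¹⁾)(a₀) ⊗ g₀⁽²⁾,…, gₙ⁽ⁿ⁺¹⁾(aₙ) ⊗ gₙ⁽ⁿ⁺²⁾)`. -/
def IsPsi (n : ℕ)
    (Psi : ((Tpow k H n : Type) ⊗[k] (Tpow k A n : Type)) →ₗ[k]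
      (Tpow k (A ⊗[k] H) n : Type)) : Prop :=
  ∀ (g : Fin (n + 1) → H) (a : Fin (n + 1) → A)
    (R : ∀ i : Fin (n + 1), IterRepr k H ((i : ℕ) + 1) (g i)),
    Psi (tpow k H n g ⊗ₜ[k] tpow k A n a) =
      ∑ e ∈ Fintype.piFinset (fun i => (R i).s),
        tpow k (A ⊗[k] H) n (fun i =>
          (rho ((List.ofFn (fun m : Fin (n + 1 - (i : ℕ)) =>
                (R ⟨(i : ℕ) + (m : ℕ), by have := m.isLt; have := i.isLt; omega⟩).leg
                  (e ⟨(i : ℕ) + (m : ℕ), by have := m.isLt; have := i.isLt; omega⟩)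
                  ⟨(i : ℕ), by have := m.isLt; have := i.isLt; simp; omega⟩)).prod)
            (a i)) ⊗ₜ[k]
          (R i).leg (e i) (Fin.last ((i : ℕ) + 1)))

/-- Spec of the cyclic operator of the cyclic module of an algebra, on `X^{⊗(n+1)}`:
`τ(x₀ ⊗ ⋯ ⊗ xₙ) = xₙ ⊗ x₀ ⊗ ⋯ ⊗ x_{n−1}`. -/
def IsAlgCyc (X : Type) [AddCommGroup X] [Module k X] (n : ℕ)
    (C : (Tpow k X n : Type) →ₗ[k] (Tpow k X n : Type)) : Prop :=
  ∀ x : Fin (n + 1) → X,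
    C (tpow k X n x) =
      tpow k X n (Fin.cases (x (Fin.last n)) (fun j : Fin n => x j.castSucc))

/-- Spec of the face `δᵢ` (`0 ≤ i < n+1`) of the cyclic module of the algebra
`(A ⊗ H, mul)`: `δᵢ(x₀ ⊗ ⋯ ⊗ x_{n+1}) = x₀ ⊗ ⋯ ⊗ xᵢx_{i+1} ⊗ ⋯ ⊗ x_{n+1}`. -/
def IsAlgFace (mul : (A ⊗[k] H) →ₗ[k] (A ⊗[k] H) →ₗ[k] (A ⊗[k] H)) (n : ℕ) (i : Fin (n + 1))
    (D : (Tpow k (A ⊗[k] H) (n + 1) : Type) →ₗ[k] (Tpow k (A ⊗[k] H) n : Type)) : Prop :=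
  ∀ x : Fin (n + 2) → A ⊗[k] H,
    D (tpow k (A ⊗[k] H) (n + 1) x) =
      tpow k (A ⊗[k] H) n (mergeAt i x (mul (x i.castSucc) (x i.succ)))

/-- Spec of the last face `δ_{n+1}` of the cyclic module of the algebra `(A ⊗ H, mul)`:
`δ_{n+1}(x₀ ⊗ ⋯ ⊗ x_{n+1}) = x_{n+1}x₀ ⊗ x₁ ⊗ ⋯ ⊗ xₙ`. -/
def IsAlgLastFace (mul : (A ⊗[k] H) →ₗ[k] (A ⊗[k] H) →ₗ[k] (A ⊗[k] H)) (n : ℕ)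
    (D : (Tpow k (A ⊗[k] H) (n + 1) : Type) →ₗ[k] (Tpow k (A ⊗[k] H) n : Type)) : Prop :=
  ∀ x : Fin (n + 2) → A ⊗[k] H,
    D (tpow k (A ⊗[k] H) (n + 1) x) =
      tpow k (A ⊗[k] H) n
        (Fin.cases (mul (x (Fin.last (n + 1))) (x 0)) (fun j : Fin n => x j.succ.castSucc))

section TensorTools

variable {k}
variable {V W M : Type} [AddCommGroup V] [Module k V] [AddCommGroup W] [Module k W]
  [AddCommGroup M] [Module k M]

/-- `V ⊗ V^{⊗(n+1)} = V^{⊗(n+2)}`, by definition of `Tpow`. -/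
def Tpow.consEquiv (V : Type) [AddCommGroup V] [Module k V] (n : ℕ) :
    (V ⊗[k] (Tpow k V n : Type)) ≃ₗ[k] (Tpow k V (n + 1) : Type) :=
  LinearEquiv.refl k (V ⊗[k] (Tpow k V n : Type))

/-- `V = V^{⊗1}`, by definition of `Tpow`. -/
def Tpow.oneEquiv (V : Type) [AddCommGroup V] [Module k V] :
    V ≃ₗ[k] (Tpow k V 0 : Type) :=
  LinearEquiv.refl k V

lemma tpow_zero (f : Fin 1 → V) : tpow k V 0 f = Tpow.oneEquiv V (f 0) := rfl

lemma tpow_succ (n : ℕ) (f : Fin (n + 2) → V) :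
    tpow k V (n + 1) f = Tpow.consEquiv V n (f 0 ⊗ₜ[k] tpow k V n (fun i => f i.succ)) := rfl

/-- Elementary tensors span `Tpow k V n`. -/
lemma Tpow.induction {n : ℕ} {P : Tpow k V n → Prop} (x : (Tpow k V n : Type))
    (hpure : ∀ f, P (tpow k V n f)) (hadd : ∀ x y, P x → P y → P (x + y)) : P x := by
  induction n with
  | zero => exact hpure (fun _ => x)
  | succ n ih =>
    obtain ⟨x, rfl⟩ := (Tpow.consEquiv V n).surjective x
    induction x using TensorProduct.induction_on with
    | zero =>
      have h := hpure 0
      rw [tpow_succ] at h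
      simpa using h
    | add x y hx hy => rw [map_add]; exact hadd _ _ hx hy
    | tmul v y =>
      refine ih (P := fun y => P (Tpow.consEquiv V n (v ⊗ₜ y))) y (fun f => ?_) (fun x y hx hy => ?_)
      · exact hpure (Fin.cons v f)
      · rw [TensorProduct.tmul_add, map_add]; exact hadd _ _ hx hy

/-- Linear maps on `Tpow k V n` are determined by elementary tensors. -/
lemma Tpow.ext {n : ℕ} {f g : (Tpow k V n : Type) →ₗ[k] M}
    (h : ∀ v, f (tpow k V n v) = g (tpow k V n v)) : f = g := by
  ext x
  induction x using Tpow.induction with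
  | hpure v => exact h v
  | hadd x y hx hy => rw [map_add, map_add, hx, hy]

lemma tpow_update_succ (n : ℕ) (f : Fin (n + 2) → V) (i : Fin (n + 1)) (z : V) :
    tpow k V (n + 1) (Function.update f i.succ z) = Tpow.consEquiv V n
      (f 0 ⊗ₜ[k] tpow k V n (Function.update (fun j => f j.succ) i z)) := by
  rw [tpow_succ, Function.update_of_ne (Fin.succ_ne_zero i).symm]
  congr 3
  ext j
  simp [Function.update_apply]

/-- The elementary tensor `tpow k V n`, as a multilinear map. -/
def tpowMultilinear (k V : Type) [Field k] [AddCommGroup V] [Module k V] (n : ℕ) :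
    MultilinearMap k (fun _ : Fin (n + 1) => V) (Tpow k V n : Type) :=
  MultilinearMap.mk' (tpow k V n)
    (by
      induction n with
      | zero =>
        intro f i x y
        obtain rfl := Fin.fin_one_eq_zero i
        simp [tpow_zero]
      | succ n ih =>
        intro f i x y
        induction i using Fin.cases with
        | zero => simp [tpow_succ, TensorProduct.add_tmul]
        | succ i => simp [tpow_update_succ, ih, TensorProduct.tmul_add])
    (by
      induction n with
      | zero =>
        intro f i x y
        obtain rfl := Fin.fin_one_eq_zero i
        simp [tpow_zero]
      | succ n ih =>
        intro f i x y
        induction i using Fin.cases with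
        | zero => simp [tpow_succ, ← TensorProduct.smul_tmul']
        | succ i => simp [tpow_update_succ, ih])

@[simp] lemma tpowMultilinear_apply (n : ℕ) (f : Fin (n + 1) → V) :
    tpowMultilinear k V n f = tpow k V n f := rfl

/-- The map `φ₀ ⊗ ⋯ ⊗ φₙ : V^{⊗(n+1)} → W^{⊗(n+1)}`. -/
def Tpow.map : (n : ℕ) → (Fin (n + 1) → V →ₗ[k] W) → (Tpow k V n : Type) →ₗ[k] (Tpow k W n : Type)
  | 0, φ => (Tpow.oneEquiv W).toLinearMap ∘ₗ φ 0 ∘ₗ (Tpow.oneEquiv V).symm.toLinearMap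
  | n + 1, φ => (Tpow.consEquiv W n).toLinearMap ∘ₗ
      TensorProduct.map (φ 0) (Tpow.map n fun i => φ i.succ) ∘ₗ
      (Tpow.consEquiv V n).symm.toLinearMap

@[simp] lemma Tpow.map_tpow (n : ℕ) (φ : Fin (n + 1) → V →ₗ[k] W) (f : Fin (n + 1) → V) :
    Tpow.map n φ (tpow k V n f) = tpow k W n (fun i => φ i (f i)) := by
  induction n with
  | zero => simp [Tpow.map, tpow_zero]
  | succ n ih => simp [Tpow.map, tpow_succ, ih]

/-- The map `V^{⊗(n+2)} → V^{⊗(n+1)} ⊗ V` splitting off the last factor. -/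
def Tpow.unsnoc (V : Type) [AddCommGroup V] [Module k V] :
    (n : ℕ) → (Tpow k V (n + 1) : Type) →ₗ[k] (Tpow k V n : Type) ⊗[k] V
  | 0 => TensorProduct.map (Tpow.oneEquiv V).toLinearMap (Tpow.oneEquiv V).symm.toLinearMap ∘ₗ
      (Tpow.consEquiv V 0).symm.toLinearMap
  | n + 1 => TensorProduct.map (Tpow.consEquiv V n).toLinearMap LinearMap.id ∘ₗ
      (TensorProduct.assoc k V (Tpow k V n) V).symm.toLinearMap ∘ₗ
      TensorProduct.map LinearMap.id (Tpow.unsnoc V n) ∘ₗ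
      (Tpow.consEquiv V (n + 1)).symm.toLinearMap

@[simp] lemma Tpow.unsnoc_tpow (n : ℕ) (f : Fin (n + 2) → V) :
    Tpow.unsnoc V n (tpow k V (n + 1) f) =
      tpow k V n (fun i => f i.castSucc) ⊗ₜ[k] f (Fin.last (n + 1)) := by
  induction n with
  | zero => simp [Tpow.unsnoc, tpow_succ, tpow_zero]
  | succ n ih =>
    rw [tpow_succ (n + 1) f]
    simp only [Tpow.unsnoc, LinearMap.comp_apply, LinearEquiv.coe_coe,
      LinearEquiv.symm_apply_apply, TensorProduct.map_tmul, ih]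
    simp [tpow_succ n]

/-- The endomorphism of `V^{⊗(n+1)}` reversing the order of the factors. -/
def Tpow.reverse (V : Type) [AddCommGroup V] [Module k V] :
    (n : ℕ) → (Tpow k V n : Type) →ₗ[k] (Tpow k V n : Type)
  | 0 => LinearMap.id
  | n + 1 => (Tpow.consEquiv V n).toLinearMap ∘ₗ
      (TensorProduct.comm k (Tpow k V n) V).toLinearMap ∘ₗ
      TensorProduct.map (Tpow.reverse V n) LinearMap.id ∘ₗ Tpow.unsnoc V n

@[simp] lemma Tpow.reverse_tpow (n : ℕ) (f : Fin (n + 1) → V) :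
    Tpow.reverse V n (tpow k V n f) = tpow k V n (fun i => f i.rev) := by
  induction n with
  | zero =>
    simp only [Tpow.reverse, LinearMap.id_apply]
    congr 1; ext i; rw [Fin.fin_one_eq_zero i]; rfl
  | succ n ih =>
    rw [tpow_succ n (fun i => f i.rev)]
    simp [Tpow.reverse, ih, Fin.rev_succ, Fin.rev_zero]

/-- The factor-by-factor action `U^{⊗(n+1)} → Hom(V^{⊗(n+1)}, W^{⊗(n+1)})` induced by
`φ : U → Hom(V, W)`. -/
def Tpow.act {U : Type} [AddCommGroup U] [Module k U] (φ : U →ₗ[k] V →ₗ[k] W) :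
    (n : ℕ) → (Tpow k U n : Type) →ₗ[k] (Tpow k V n : Type) →ₗ[k] (Tpow k W n : Type)
  | 0 => (LinearEquiv.arrowCongr (Tpow.oneEquiv V) (Tpow.oneEquiv W)).toLinearMap ∘ₗ φ ∘ₗ
      (Tpow.oneEquiv U).symm.toLinearMap
  | n + 1 => (LinearEquiv.arrowCongr (Tpow.consEquiv V n) (Tpow.consEquiv W n)).toLinearMap ∘ₗ
      TensorProduct.homTensorHomMap (RingHom.id k) V (Tpow k V n) W (Tpow k W n) ∘ₗ
      TensorProduct.map φ (Tpow.act φ n) ∘ₗ (Tpow.consEquiv U n).symm.toLinearMap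

@[simp] lemma Tpow.act_tpow {U : Type} [AddCommGroup U] [Module k U] (φ : U →ₗ[k] V →ₗ[k] W)
    (n : ℕ) (u : Fin (n + 1) → U) (v : Fin (n + 1) → V) :
    Tpow.act φ n (tpow k U n u) (tpow k V n v) = tpow k W n (fun i => φ (u i) (v i)) := by
  induction n with
  | zero => simp [Tpow.act, tpow_zero]
  | succ n ih => simp [Tpow.act, tpow_succ, ih]

end TensorTools

section Comultiplication

variable {k H}

lemma comulIter_zero (h : H) : comulIter k H 0 h = Tpow.oneEquiv H h := rfl

lemma comulIter_succ (n : ℕ) (h : H) : comulIter k H (n + 1) h =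
    Tpow.consEquiv H n (TensorProduct.map LinearMap.id (comulIter k H n) (Coalgebra.comul h)) := rfl

lemma IterRepr.nonempty (n : ℕ) (h : H) : Nonempty (IterRepr k H n h) := by
  have key (x : (Tpow k H n : Type)) : ∃ (ι : Type) (s : Finset ι) (leg : ι → Fin (n + 1) → H),
      ∑ i ∈ s, tpow k H n (leg i) = x := by
    induction x using Tpow.induction with
    | hpure f => exact ⟨Unit, {()}, fun _ => f, by simp⟩
    | hadd x y hx hy =>
      obtain ⟨ι, s, f, rfl⟩ := hx
      obtain ⟨κ, t, g, rfl⟩ := hy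
      exact ⟨ι ⊕ κ, s.disjSum t, Sum.elim f g, by simp [Finset.sum_disjSum]⟩
  obtain ⟨ι, s, leg, h⟩ := key (comulIter k H n h)
  exact ⟨⟨ι, s, leg, h⟩⟩

/-- A chosen representation of the iterated comultiplication. -/
def IterRepr.arbitrary (n : ℕ) (h : H) : IterRepr k H n h :=
  (IterRepr.nonempty n h).some

lemma IterRepr.comul_eq {h : H} (R : IterRepr k H 1 h) :
    Coalgebra.comul (R := k) h = ∑ i ∈ R.s, R.leg i 0 ⊗ₜ[k] R.leg i 1 := by
  have e : TensorProduct.map LinearMap.id LinearMap.id (Coalgebra.comul (R := k) h) =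
      Coalgebra.comul (R := k) h := by simp
  exact e.symm.trans R.eq.symm

/-- Splitting off the last leg of the iterated comultiplication: `(Δ⁽ⁿ⁾ ⊗ 1) ∘ Δ = Δ⁽ⁿ⁺¹⁾`. -/
lemma unsnoc_comulIter (n : ℕ) (h : H) : Tpow.unsnoc H n (comulIter k H (n + 1) h) =
    TensorProduct.map (comulIter k H n) LinearMap.id (Coalgebra.comul h) := by
  induction n generalizing h with
  | zero =>
    rw [comulIter_succ]
    generalize Coalgebra.comul (R := k) h = x
    induction x using TensorProduct.induction_on with
    | zero => simp
    | add x y hx hy => simp only [map_add, hx, hy]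
    | tmul x y => simp [Tpow.unsnoc, comulIter_zero]
  | succ n ih =>
    have hl (x : H ⊗[k] H) : Tpow.unsnoc H (n + 1)
        (Tpow.consEquiv H (n + 1) (TensorProduct.map LinearMap.id (comulIter k H (n + 1)) x)) =
        TensorProduct.map ((Tpow.consEquiv H n).toLinearMap ∘ₗ
          TensorProduct.map LinearMap.id (comulIter k H n)) LinearMap.id
          ((TensorProduct.assoc k H H H).symm (Coalgebra.comul.lTensor H x)) := by
      induction x using TensorProduct.induction_on with
      | zero => simp
      | add x y hx hy => simp only [map_add, hx, hy]
      | tmul x y =>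
        simp only [Tpow.unsnoc, LinearMap.comp_apply, LinearEquiv.coe_coe,
          LinearEquiv.symm_apply_apply, TensorProduct.map_tmul, ih, LinearMap.id_apply,
          LinearMap.lTensor_tmul]
        generalize Coalgebra.comul (R := k) y = z
        induction z using TensorProduct.induction_on with
        | zero => simp
        | add x y hx hy => simp only [map_add, TensorProduct.tmul_add, hx, hy]
        | tmul y z => simp
    have hr (x : H ⊗[k] H) : TensorProduct.map (comulIter k H (n + 1)) LinearMap.id x =
        TensorProduct.map ((Tpow.consEquiv H n).toLinearMap ∘ₗ
          TensorProduct.map LinearMap.id (comulIter k H n)) LinearMap.id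
          (Coalgebra.comul.rTensor H x) := by
      induction x using TensorProduct.induction_on with
      | zero => simp
      | add x y hx hy => simp only [map_add, hx, hy]
      | tmul x y => simp [comulIter_succ]
    rw [comulIter_succ, hl, hr, Coalgebra.coassoc_symm_apply]

/-- Comultiplication of the last factor of `H^{⊗(n+1)}`. -/
def Tpow.comulLast (k H : Type) [Field k] [Ring H] [HopfAlgebra k H] :
    (n : ℕ) → (Tpow k H n : Type) →ₗ[k] (Tpow k H (n + 1) : Type)
  | 0 => comulIter k H 1 ∘ₗ (Tpow.oneEquiv H).symm.toLinearMap
  | n + 1 => (Tpow.consEquiv H (n + 1)).toLinearMap ∘ₗ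
      TensorProduct.map LinearMap.id (Tpow.comulLast k H n) ∘ₗ
      (Tpow.consEquiv H n).symm.toLinearMap

lemma Tpow.comulLast_comulIter (n : ℕ) (h : H) :
    Tpow.comulLast k H n (comulIter k H n h) = comulIter k H (n + 1) h := by
  induction n generalizing h with
  | zero => simp [Tpow.comulLast, comulIter_zero]
  | succ n ih =>
    rw [comulIter_succ n, comulIter_succ (n + 1)]
    generalize Coalgebra.comul (R := k) h = x
    induction x using TensorProduct.induction_on with
    | zero => simp
    | add x y hx hy => simp only [map_add, hx, hy]
    | tmul x y => simp [Tpow.comulLast, ih]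

lemma Tpow.comulLast_tpow (n : ℕ) (f : Fin (n + 1) → H) (Q : IterRepr k H 1 (f (Fin.last n))) :
    Tpow.comulLast k H n (tpow k H n f) = ∑ i ∈ Q.s, tpow k H (n + 1)
      (Fin.snoc (α := fun _ => H) (Function.update f (Fin.last n) (Q.leg i 0)) (Q.leg i 1)) := by
  induction n with
  | zero =>
    simp only [Tpow.comulLast, tpow_zero, LinearMap.comp_apply, LinearEquiv.coe_coe,
      LinearEquiv.symm_apply_apply]
    refine Q.eq.symm.trans (Finset.sum_congr rfl fun i _ => congrArg _ ?_)
    ext j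
    fin_cases j <;> simp [Fin.snoc]
  | succ n ih =>
    rw [tpow_succ]
    simp only [Tpow.comulLast, LinearMap.comp_apply, LinearEquiv.coe_coe,
      LinearEquiv.symm_apply_apply, TensorProduct.map_tmul, LinearMap.id_apply]
    rw [ih (fun i => f i.succ) Q, TensorProduct.tmul_sum, map_sum]
    refine Finset.sum_congr rfl fun i _ => ?_
    rw [tpow_succ (n + 1)]
    congr 3
    ext j
    induction j using Fin.lastCases with
    | last => simp only [Fin.succ_last, Fin.snoc_last]
    | cast j =>
      rw [← Fin.castSucc_succ]
      simp only [Fin.snoc_castSucc, Function.update_apply, Fin.ext_iff, Fin.val_succ,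
        Fin.val_last, add_left_inj]

/-- The representation of `Δ⁽ⁿ⁺¹⁾ h` obtained from one of `Δ⁽ⁿ⁾ h` by comultiplying the last
leg. -/
def IterRepr.splitLast {n : ℕ} {h : H} (R : IterRepr k H n h)
    (Q : ∀ x : R.ι, IterRepr k H 1 (R.leg x (Fin.last n))) : IterRepr k H (n + 1) h where
  ι := Σ x : R.ι, (Q x).ι
  s := R.s.sigma fun x => (Q x).s
  leg p := Fin.snoc (α := fun _ => H)
    (Function.update (R.leg p.1) (Fin.last n) ((Q p.1).leg p.2 0)) ((Q p.1).leg p.2 1)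
  eq := by
    rw [Finset.sum_sigma, ← Tpow.comulLast_comulIter, ← R.eq, map_sum]
    exact Finset.sum_congr rfl fun x _ => (Tpow.comulLast_tpow n _ (Q x)).symm

end Comultiplication

section Cancellation

variable {k H A}

/-- The diagonal action `h ↦ (a₀ ⊗ ⋯ ⊗ aₙ ↦ h⁽¹⁾(a₀) ⊗ ⋯ ⊗ h⁽ⁿ⁺¹⁾(aₙ))`. -/
def diagAct (n : ℕ) : H →ₗ[k] Module.End k (Tpow k A n : Type) :=
  Tpow.act rho n ∘ₗ comulIter k H n

/-- The map `h ↦ (a₀ ⊗ ⋯ ⊗ aₙ ↦ S(h⁽ⁿ⁺¹⁾)(a₀) ⊗ ⋯ ⊗ S(h⁽¹⁾)(aₙ))`. -/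
def diagActInv (n : ℕ) : H →ₗ[k] Module.End k (Tpow k A n : Type) :=
  Tpow.act rho n ∘ₗ Tpow.map n (fun _ => HopfAlgebra.antipode k) ∘ₗ Tpow.reverse H n ∘ₗ
    comulIter k H n

/-- `f ↦ f ⊗ 1 ⊗ ⋯ ⊗ 1`. -/
def headEnd (k V : Type) [Field k] [AddCommGroup V] [Module k V] (n : ℕ) :
    Module.End k V →ₐ[k] Module.End k (Tpow k V (n + 1) : Type) :=
  (Tpow.consEquiv V n).conjAlgEquiv k |>.toAlgHom.comp (Module.End.rTensorAlgHom k V (Tpow k V n))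

/-- `f ↦ 1 ⊗ f`. -/
def tailEnd (k V : Type) [Field k] [AddCommGroup V] [Module k V] (n : ℕ) :
    Module.End k (Tpow k V n : Type) →ₐ[k] Module.End k (Tpow k V (n + 1) : Type) :=
  (Tpow.consEquiv V n).conjAlgEquiv k |>.toAlgHom.comp (Module.End.lTensorAlgHom k (Tpow k V n) V)

variable {V : Type} [AddCommGroup V] [Module k V]

lemma headEnd_cons (n : ℕ) (f : Module.End k V) (v : V) (t : (Tpow k V n : Type)) :
    headEnd k V n f (Tpow.consEquiv V n (v ⊗ₜ t)) = Tpow.consEquiv V n (f v ⊗ₜ t) := rfl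

lemma tailEnd_cons (n : ℕ) (f : Module.End k (Tpow k V n : Type)) (v : V)
    (t : (Tpow k V n : Type)) :
    tailEnd k V n f (Tpow.consEquiv V n (v ⊗ₜ t)) = Tpow.consEquiv V n (v ⊗ₜ f t) := rfl

lemma Tpow.act_cons {U : Type} [AddCommGroup U] [Module k U] (φ : U →ₗ[k] V →ₗ[k] V)
    (n : ℕ) (u : U) (t : (Tpow k U n : Type)) :
    Tpow.act φ (n + 1) (Tpow.consEquiv U n (u ⊗ₜ t)) =
      headEnd k V n (φ u) * tailEnd k V n (Tpow.act φ n t) := by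
  refine Tpow.ext fun v => ?_
  rw [tpow_succ, Module.End.mul_apply, tailEnd_cons, headEnd_cons]
  simp [Tpow.act]

lemma headEnd_mul_tailEnd_comm (n : ℕ) (f : Module.End k V)
    (g : Module.End k (Tpow k V n : Type)) :
    headEnd k V n f * tailEnd k V n g = tailEnd k V n g * headEnd k V n f := by
  refine Tpow.ext fun v => ?_
  simp only [tpow_succ, Module.End.mul_apply, tailEnd_cons, headEnd_cons]

open WithConv in
lemma diagAct_succ (n : ℕ) : toConv (diagAct rho (n + 1)) =
    toConv ((headEnd k A n).toLinearMap ∘ₗ rho) *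
      toConv ((tailEnd k A n).toLinearMap ∘ₗ diagAct rho n) := by
  ext h : 2
  rw [LinearMap.convMul_apply]
  simp only [diagAct, LinearMap.comp_apply, comulIter_succ]
  generalize Coalgebra.comul (R := k) h = x
  induction x using TensorProduct.induction_on with
  | zero => simp
  | add x y hx hy => simp only [map_add, hx, hy]
  | tmul x y => simp [Tpow.act_cons]

open WithConv in
lemma diagActInv_succ (n : ℕ) : toConv (diagActInv rho (n + 1)) =
    toConv ((tailEnd k A n).toLinearMap ∘ₗ diagActInv rho n) *
      toConv ((headEnd k A n).toLinearMap ∘ₗ rho ∘ₗ HopfAlgebra.antipode k) := by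
  ext h : 2
  rw [LinearMap.convMul_apply]
  simp only [diagActInv, LinearMap.comp_apply, Tpow.reverse, unsnoc_comulIter]
  generalize Coalgebra.comul (R := k) h = x
  induction x using TensorProduct.induction_on with
  | zero => simp
  | add x y hx hy => simp only [map_add, hx, hy]
  | tmul x y => simp [Tpow.map, Tpow.act_cons, headEnd_mul_tailEnd_comm]

variable {rho}

/-- The action of `H` on `A`, as a morphism of algebras `H → End A`. -/
def IsModuleAlgebraAction.algHom (hma : IsModuleAlgebraAction k H A rho) :
    H →ₐ[k] Module.End k A :=
  AlgHom.ofLinearMap rho (LinearMap.ext hma.1.2.2) fun h l => LinearMap.ext (hma.2 h l)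

open WithConv in
lemma AlgHom.comp_convMul_comp_eq_one {B B' : Type} [Ring B] [Ring B'] [Algebra k B] [Algebra k B']
    (φ : B →ₐ[k] B') {f g : H →ₗ[k] B} (h : toConv f * toConv g = 1) :
    toConv (φ.toLinearMap ∘ₗ f) * toConv (φ.toLinearMap ∘ₗ g) = 1 := by
  have h' := LinearMap.algHom_comp_convMul_distrib φ (toConv f) (toConv g)
  rw [h] at h'
  refine ofConv_injective (h'.symm.trans ?_)
  ext c : 1
  simp [LinearMap.convOne_def]

open WithConv in
lemma rho_convMul_antipode (hma : IsModuleAlgebraAction k H A rho) :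
    toConv rho * toConv (rho ∘ₗ HopfAlgebra.antipode k) = 1 := by
  have h := hma.algHom.comp_convMul_comp_eq_one (LinearMap.id_mul_antipode (R := k) (C := H))
  have hrho : hma.algHom.toLinearMap = rho := rfl
  rwa [LinearMap.comp_id, hrho] at h

open WithConv in
/-- `diagActInv` is right convolution inverse to `diagAct`. -/
lemma diagAct_convMul_diagActInv (hma : IsModuleAlgebraAction k H A rho) (n : ℕ) :
    toConv (diagAct rho n) * toConv (diagActInv rho n) = 1 := by
  induction n with
  | zero =>
    have h₁ : diagAct rho 0 = ((Tpow.oneEquiv A).conjAlgEquiv k).toAlgHom.toLinearMap ∘ₗ rho := rfl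
    have h₂ : diagActInv rho 0 = ((Tpow.oneEquiv A).conjAlgEquiv k).toAlgHom.toLinearMap ∘ₗ
      rho ∘ₗ HopfAlgebra.antipode k := rfl
    rw [h₁, h₂]
    exact AlgHom.comp_convMul_comp_eq_one _ (rho_convMul_antipode hma)
  | succ n ih =>
    rw [diagAct_succ, diagActInv_succ, mul_assoc, ← mul_assoc (toConv (_ ∘ₗ diagAct rho n)),
      (tailEnd k A n).comp_convMul_comp_eq_one ih, one_mul]
    exact (headEnd k A n).comp_convMul_comp_eq_one (rho_convMul_antipode hma)

end Cancellation

section CyclicOperator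

variable {k H A rho}

/-- The map `z ↦ z ⊗ G₀ ⊗ ⋯ ⊗ G_{p-1}`. -/
def consMap {p : ℕ} (G : Fin p → H) : H →ₗ[k] (Tpow k H p : Type) :=
  (tpowMultilinear k H p).toLinearMap (Fin.cons (α := fun _ => H) 0 G) 0

/-- The map `z ↦ G₀ ⊗ ⋯ ⊗ G_{p-1} ⊗ z`. -/
def snocMap {p : ℕ} (G : Fin p → H) : H →ₗ[k] (Tpow k H p : Type) :=
  (tpowMultilinear k H p).toLinearMap (Fin.snoc (α := fun _ => H) G 0) (Fin.last p)

lemma consMap_apply {p : ℕ} (G : Fin p → H) (z : H) :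
    consMap (k := k) G z = tpow k H p (Fin.cons (α := fun _ => H) z G) := by
  simp [consMap, Fin.update_cons_zero]

lemma snocMap_apply {p : ℕ} (G : Fin p → H) (z : H) :
    snocMap (k := k) G z = tpow k H p (Fin.snoc (α := fun _ => H) G z) := by
  simp [snocMap, Fin.update_snoc_last]

variable {p q : ℕ} {T : ((Tpow k H p : Type) ⊗[k] (Tpow k A q : Type)) →ₗ[k]
  ((Tpow k H p : Type) ⊗[k] (Tpow k A q : Type))}

/-- `t(G, z | w) = (z⁽²⁾, G | z⁽¹⁾ w)`. -/
lemma IsCycT.apply_snocMap (hT : IsCycT k H A rho p q T) (G : Fin p → H) (z : H)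
    (w : (Tpow k A q : Type)) : T (snocMap G z ⊗ₜ w) =
      TensorProduct.map (consMap G) ((diagAct rho q).flip w)
        (TensorProduct.comm k H H (Coalgebra.comul z)) := by
  induction w using Tpow.induction with
  | hadd x y hx hy =>
    simp only [map_add, TensorProduct.tmul_add, hx, hy, TensorProduct.map_add_right,
      LinearMap.add_apply]
  | hpure a =>
    let R := IterRepr.arbitrary (k := k) (q + 1) (Fin.snoc (α := fun _ => H) G z (Fin.last p))
    have hR : ∑ x ∈ R.s, tpow k H (q + 1) (R.leg x) = comulIter k H (q + 1) z :=
      R.eq.trans (congrArg _ (Fin.snoc_last _ _))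
    have hL (x : H ⊗[k] H) : TensorProduct.map (consMap G) ((diagAct rho q).flip (tpow k A q a))
        (TensorProduct.comm k H H x) =
          TensorProduct.map (consMap G) ((Tpow.act rho q).flip (tpow k A q a))
            (TensorProduct.comm k _ _ (TensorProduct.map (comulIter k H q) LinearMap.id x)) := by
      induction x using TensorProduct.induction_on with
      | zero => simp
      | add x y hx hy => simp only [map_add, hx, hy]
      | tmul x y => simp [diagAct]
    rw [snocMap_apply, hT _ a R, hL, ← unsnoc_comulIter, ← hR]
    simp only [map_sum]
    refine Finset.sum_congr rfl fun x _ => ?_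
    simp only [Tpow.unsnoc_tpow, TensorProduct.comm_tmul, TensorProduct.map_tmul, consMap_apply,
      LinearMap.flip_apply, Tpow.act_tpow, Fin.snoc_castSucc]
    rfl

/-- `h⁽²⁾ S(h⁽¹⁾) = ε(h)` for the diagonal action of a cocommutative `H`. -/
lemma diagAct_mul_diagActInv_comm (hco : Cocomm k H) (hma : IsModuleAlgebraAction k H A rho)
    (h : H) : LinearMap.mul' k (Module.End k (Tpow k A q : Type))
      (TensorProduct.map (diagAct rho q) (diagActInv rho q)
        (TensorProduct.comm k H H (Coalgebra.comul h))) =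
      algebraMap k _ (Coalgebra.counit (R := k) h) := by
  rw [hco h]
  exact congrArg (fun f => f.ofConv h) (diagAct_convMul_diagActInv hma q)

/-- `t(G, l⁽²⁾ | S(l⁽¹⁾) v) = (l, G | v)`. -/
lemma IsCycT.apply_diagActInv (hco : Cocomm k H) (hma : IsModuleAlgebraAction k H A rho)
    (hT : IsCycT k H A rho p q T) (G : Fin p → H) (v : (Tpow k A q : Type)) (l : H) :
    T (TensorProduct.map (snocMap G) ((diagActInv rho q).flip v)
      (TensorProduct.comm k H H (Coalgebra.comul l))) = consMap G l ⊗ₜ v := by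
  let F : (H ⊗[k] H) ⊗[k] H →ₗ[k] (Tpow k H p : Type) ⊗[k] (Tpow k A q : Type) :=
    TensorProduct.map (consMap G) (LinearMap.applyₗ v ∘ₗ LinearMap.mul' k _ ∘ₗ
      TensorProduct.map (diagAct rho q) (diagActInv rho q) ∘ₗ
        (TensorProduct.comm k H H).toLinearMap) ∘ₗ (TensorProduct.comm k _ _).toLinearMap
  have h₁ (x : H ⊗[k] H) : T (TensorProduct.map (snocMap G) ((diagActInv rho q).flip v)
      (TensorProduct.comm k H H x)) =
        F ((TensorProduct.assoc k H H H).symm (Coalgebra.comul.lTensor H x)) := by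
    induction x using TensorProduct.induction_on with
    | zero => simp
    | add x y hx hy => simp only [map_add, hx, hy]
    | tmul x y =>
      rw [TensorProduct.comm_tmul, TensorProduct.map_tmul, hT.apply_snocMap,
        LinearMap.lTensor_tmul]
      generalize Coalgebra.comul (R := k) y = z
      induction z using TensorProduct.induction_on with
      | zero => simp
      | add x y hx hy => simp only [map_add, TensorProduct.tmul_add, hx, hy]
      | tmul y z => simp [F]
  have h₂ (x : H ⊗[k] H) : F (Coalgebra.comul.rTensor H x) =
      consMap G (TensorProduct.lid k H (Coalgebra.counit.rTensor H x)) ⊗ₜ v := by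
    induction x using TensorProduct.induction_on with
    | zero => simp
    | add x y hx hy => simp only [map_add, TensorProduct.add_tmul, hx, hy]
    | tmul x y =>
      simp [F, diagAct_mul_diagActInv_comm hco hma, TensorProduct.smul_tmul]
  rw [h₁, Coalgebra.coassoc_symm_apply, h₂, Coalgebra.rTensor_counit_comul]
  simp

/-- `t(G, h⁽ⁿ⁺³⁾ | S(h⁽ⁿ⁺²⁾) v₀(h⁽¹⁾), …, S(h⁽²⁾) vₙ(h⁽¹⁾)) = (h⁽²⁾, G | V(h⁽¹⁾))`, where
`V = v₀ ⊗ ⋯ ⊗ vₙ` depends linearly on `h⁽¹⁾`. -/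
lemma IsCycT.sum_apply (hco : Cocomm k H) (hma : IsModuleAlgebraAction k H A rho)
    (hT : IsCycT k H A rho p q T) (G : Fin p → H) (V : H →ₗ[k] (Tpow k A q : Type))
    (v : H → Fin (q + 1) → A) (hV : ∀ l, V l = tpow k A q (v l)) {h : H}
    (R : IterRepr k H (q + 2) h) (Q : IterRepr k H 1 h) :
    ∑ x ∈ R.s, T (tpow k H p (Fin.snoc (α := fun _ => H) G (R.leg x (Fin.last (q + 2)))) ⊗ₜ[k]
      tpow k A q (fun i => rho (HopfAlgebra.antipode k (R.leg x i.rev.castSucc.succ))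
        (v (R.leg x 0) i))) =
    ∑ y ∈ Q.s, tpow k H p (Fin.cons (α := fun _ => H) (Q.leg y 1) G) ⊗ₜ[k]
      tpow k A q (v (Q.leg y 0)) := by
  let U : H →ₗ[k] (Tpow k H q : Type) ⊗[k] H →ₗ[k]
      (Tpow k H p : Type) ⊗[k] (Tpow k A q : Type) :=
    LinearMap.mk₂ k (fun l x => T (TensorProduct.map (snocMap G)
      ((Tpow.act rho q ∘ₗ Tpow.map q (fun _ => HopfAlgebra.antipode k) ∘ₗ
        Tpow.reverse H q).flip (V l)) (TensorProduct.comm k _ _ x)))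
      (fun l l' x => by simp [TensorProduct.map_add_right])
      (fun c l x => by simp [TensorProduct.map_smul_right])
      (fun l x x' => by simp)
      (fun c l x => by simp)
  let Θ : (Tpow k H (q + 2) : Type) →ₗ[k] (Tpow k H p : Type) ⊗[k] (Tpow k A q : Type) :=
    TensorProduct.lift U ∘ₗ (Tpow.unsnoc H q).lTensor H ∘ₗ
      (Tpow.consEquiv H (q + 1)).symm.toLinearMap
  have hΘ (x : H ⊗[k] H) : Θ (Tpow.consEquiv H (q + 1) (TensorProduct.map LinearMap.id
      (comulIter k H (q + 1)) x)) =
        TensorProduct.map (consMap G) V (TensorProduct.comm k H H x) := by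
    induction x using TensorProduct.induction_on with
    | zero => simp
    | add x y hx hy => simp only [map_add, hx, hy]
    | tmul x y =>
      rw [TensorProduct.comm_tmul, TensorProduct.map_tmul (consMap G),
        ← hT.apply_diagActInv hco hma]
      simp only [Θ, LinearMap.comp_apply, LinearEquiv.coe_coe, LinearEquiv.symm_apply_apply,
        TensorProduct.map_tmul, LinearMap.lTensor_tmul, unsnoc_comulIter, TensorProduct.lift.tmul,
        LinearMap.id_apply]
      generalize Coalgebra.comul (R := k) y = z
      induction z using TensorProduct.induction_on with
      | zero => simp
      | add x y hx hy => simp only [map_add, hx, hy]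
      | tmul y z => simp [U, diagActInv]
  trans Θ (comulIter k H (q + 2) h)
  · rw [← R.eq, map_sum]
    refine Finset.sum_congr rfl fun x _ => ?_
    rw [tpow_succ]
    simp [Θ, U, hV, snocMap_apply]
  · rw [comulIter_succ, hΘ, Q.comul_eq]
    simp [hV, consMap_apply]

end CyclicOperator

section Tables

variable {k H}

/-- Linear maps on `(V ⊗ W)^{⊗(n+1)}` are determined by their values on the tensors
`(v₀ ⊗ w₀) ⊗ ⋯ ⊗ (vₙ ⊗ wₙ)`. -/
lemma Tpow.ext_tmul {V W M : Type} [AddCommGroup V] [Module k V] [AddCommGroup W] [Module k W]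
    [AddCommGroup M] [Module k M] {n : ℕ} {f g : (Tpow k (V ⊗[k] W) n : Type) →ₗ[k] M}
    (h : ∀ (v : Fin (n + 1) → V) (w : Fin (n + 1) → W), f (tpow k (V ⊗[k] W) n fun i => v i ⊗ₜ w i) =
      g (tpow k (V ⊗[k] W) n fun i => v i ⊗ₜ w i)) : f = g := by
  have key {n : ℕ} {P : Tpow k (V ⊗[k] W) n → Prop} (x : (Tpow k (V ⊗[k] W) n : Type))
      (hpure : ∀ (v : Fin (n + 1) → V) (w : Fin (n + 1) → W),
        P (tpow k (V ⊗[k] W) n fun i => v i ⊗ₜ w i)) (hzero : P 0)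
      (hadd : ∀ x y, P x → P y → P (x + y)) : P x := by
    induction n with
    | zero =>
      obtain ⟨x, rfl⟩ := (Tpow.oneEquiv (k := k) (V ⊗[k] W)).surjective x
      induction x using TensorProduct.induction_on with
      | zero => rwa [map_zero]
      | add x y hx hy => rw [map_add]; exact hadd _ _ hx hy
      | tmul v w => exact hpure (fun _ => v) (fun _ => w)
    | succ n ih =>
      obtain ⟨x, rfl⟩ := (Tpow.consEquiv (V ⊗[k] W) n).surjective x
      induction x using TensorProduct.induction_on with
      | zero => rwa [map_zero]
      | add x y hx hy => rw [map_add]; exact hadd _ _ hx hy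
      | tmul u y =>
        induction u using TensorProduct.induction_on with
        | zero => rwa [TensorProduct.zero_tmul, map_zero]
        | add u u' hu hu' => rw [TensorProduct.add_tmul, map_add]; exact hadd _ _ hu hu'
        | tmul v w =>
          refine ih (P := fun y => P (Tpow.consEquiv _ n ((v ⊗ₜ w) ⊗ₜ y))) y (fun v' w' => ?_) ?_
            fun x y hx hy => ?_
          · exact hpure (Fin.cons v v') (Fin.cons w w')
          · rwa [TensorProduct.tmul_zero, map_zero]
          · rw [TensorProduct.tmul_add, map_add]; exact hadd _ _ hx hy
  ext x
  exact key (P := fun x => f x = g x) x h (by simp) fun x y hx hy => by rw [map_add, map_add, hx, hy]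

lemma sum_piFinset_sigma {ι M : Type} [Fintype ι] [DecidableEq ι] [AddCommMonoid M]
    {α : ι → Type} {β : ∀ i, α i → Type} (s : ∀ i, Finset (α i)) (t : ∀ i x, Finset (β i x))
    (F : (∀ i, Σ x, β i x) → M) :
    ∑ p ∈ Fintype.piFinset fun i => (s i).sigma (t i), F p =
      ∑ e ∈ Fintype.piFinset s, ∑ f ∈ Fintype.piFinset fun i => t i (e i),
        F fun i => ⟨e i, f i⟩ := by
  rw [Finset.sum_sigma']
  refine Finset.sum_nbij' (fun p => ⟨fun i => (p i).1, fun i => (p i).2⟩)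
    (fun q i => ⟨q.1 i, q.2 i⟩) ?_ ?_ ?_ ?_ ?_
  · intro p hp
    simp only [Fintype.mem_piFinset, Finset.mem_sigma] at hp ⊢
    exact ⟨fun i => (hp i).1, fun i => (hp i).2⟩
  · intro q hq
    simp only [Fintype.mem_piFinset, Finset.mem_sigma] at hq ⊢
    exact fun i => ⟨hq.1 i, hq.2 i⟩
  all_goals intros; rfl

lemma sum_piFinset_cons {M : Type} [AddCommMonoid M] {n : ℕ} {α : Fin (n + 1) → Type}
    (s : ∀ i, Finset (α i)) (F : (∀ i, α i) → M) :
    ∑ e ∈ Fintype.piFinset s, F e =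
      ∑ x ∈ s 0, ∑ e ∈ Fintype.piFinset fun i : Fin n => s i.succ, F (Fin.cons x e) := by
  rw [Finset.sum_sigma']
  refine Finset.sum_nbij' (fun e => ⟨e 0, Fin.tail e⟩) (fun q => Fin.cons q.1 q.2) ?_ ?_ ?_ ?_ ?_
  · intro p hp
    simp only [Fintype.mem_piFinset, Finset.mem_sigma] at hp ⊢
    exact ⟨hp 0, fun i => hp i.succ⟩
  · intro q hq
    simp only [Fintype.mem_piFinset, Finset.mem_sigma] at hq ⊢
    exact Fin.cases hq.1 hq.2
  all_goals simp

lemma sum_piFinset_snoc {M : Type} [AddCommMonoid M] {n : ℕ} {α : Fin (n + 1) → Type}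
    (s : ∀ i, Finset (α i)) (F : (∀ i, α i) → M) :
    ∑ e ∈ Fintype.piFinset s, F e =
      ∑ e ∈ Fintype.piFinset fun i : Fin n => s i.castSucc, ∑ x ∈ s (Fin.last n),
        F (Fin.snoc e x) := by
  rw [Finset.sum_sigma']
  refine Finset.sum_nbij' (fun e => ⟨Fin.init e, e (Fin.last n)⟩) (fun q => Fin.snoc q.1 q.2)
    ?_ ?_ ?_ ?_ ?_
  · intro p hp
    simp only [Fintype.mem_piFinset, Finset.mem_sigma] at hp ⊢
    exact ⟨fun i => hp i.castSucc, hp _⟩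
  · intro q hq
    simp only [Fintype.mem_piFinset, Finset.mem_sigma] at hq ⊢
    exact Fin.lastCases (by simpa using hq.2) (by simpa using hq.1)
  all_goals simp

/-- A family of finite tuples of possibly different lengths, extended by `1` to an infinite
table. -/
def table {N : ℕ} {d : Fin N → ℕ} (L : ∀ i, Fin (d i) → H) (i m : ℕ) : H :=
  if hi : i < N then if hm : m < d ⟨i, hi⟩ then L ⟨i, hi⟩ ⟨m, hm⟩ else 1 else 1

lemma table_eq {N : ℕ} {d : Fin N → ℕ} (L : ∀ i, Fin (d i) → H) {i m : ℕ} (hi : i < N)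
    (hm : m < d ⟨i, hi⟩) : table L i m = L ⟨i, hi⟩ ⟨m, hm⟩ := by
  rw [table, dif_pos hi, dif_pos hm]

/-- The product `ℓ i j * ℓ (i+1) (j+1) * ⋯` with `N` factors. -/
def diagProd (ℓ : ℕ → ℕ → H) (i j N : ℕ) : H :=
  ((List.range N).map fun m => ℓ (i + m) (j + m)).prod

lemma diagProd_succ (ℓ : ℕ → ℕ → H) (i j N : ℕ) :
    diagProd ℓ i j (N + 1) = diagProd ℓ i j N * ℓ (i + N) (j + N) := by
  simp [diagProd, List.range_succ]

lemma diagProd_succ' (ℓ : ℕ → ℕ → H) (i j N : ℕ) :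
    diagProd ℓ i j (N + 1) = ℓ i j * diagProd ℓ (i + 1) (j + 1) N := by
  simp [diagProd, List.range_succ_eq_map, Function.comp_def, add_assoc, add_comm 1]

lemma prod_ofFn_eq_diagProd (ℓ : ℕ → ℕ → H) (i j : ℕ) {N : ℕ} (F : Fin N → H)
    (hF : ∀ m : Fin N, F m = ℓ (i + m) (j + m)) : (List.ofFn F).prod = diagProd ℓ i j N := by
  rw [diagProd]
  congr 1
  exact List.ext_getElem (by simp) (by simp [hF])

lemma diagProd_congr {ℓ ℓ' : ℕ → ℕ → H} {i i' j j' N : ℕ}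
    (h : ∀ m < N, ℓ (i + m) (j + m) = ℓ' (i' + m) (j' + m)) :
    diagProd ℓ i j N = diagProd ℓ' i' j' N := by
  rw [diagProd, diagProd]
  congr 1
  exact List.map_congr_left fun m hm => h m (List.mem_range.1 hm)

end Tables

section Intertwining

variable {k H A rho}

lemma IterRepr.splitLast_leg_last {n : ℕ} {h : H} (R : IterRepr k H n h)
    (Q : ∀ x : R.ι, IterRepr k H 1 (R.leg x (Fin.last n))) (x : R.ι) (y : (Q x).ι) :
    (R.splitLast Q).leg ⟨x, y⟩ (Fin.last (n + 1)) = (Q x).leg y 1 := by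
  simp [IterRepr.splitLast]

lemma IterRepr.splitLast_leg_castSucc_last {n : ℕ} {h : H} (R : IterRepr k H n h)
    (Q : ∀ x : R.ι, IterRepr k H 1 (R.leg x (Fin.last n))) (x : R.ι) (y : (Q x).ι) :
    (R.splitLast Q).leg ⟨x, y⟩ (Fin.last n).castSucc = (Q x).leg y 0 := by
  simp [IterRepr.splitLast]

lemma IterRepr.splitLast_leg_of_ne {n : ℕ} {h : H} (R : IterRepr k H n h)
    (Q : ∀ x : R.ι, IterRepr k H 1 (R.leg x (Fin.last n))) (x : R.ι) (y : (Q x).ι)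
    (j : Fin (n + 1)) (hj : j ≠ Fin.last n) :
    (R.splitLast Q).leg ⟨x, y⟩ j.castSucc = R.leg x j := by
  simp [IterRepr.splitLast, Function.update_of_ne hj]

variable {n : ℕ} {Phi : (Tpow k (A ⊗[k] H) n : Type) →ₗ[k]
    ((Tpow k H n : Type) ⊗[k] (Tpow k A n : Type))}
  {T Tau : ((Tpow k H n : Type) ⊗[k] (Tpow k A n : Type)) →ₗ[k]
    ((Tpow k H n : Type) ⊗[k] (Tpow k A n : Type))}

lemma IsPhi.apply_table (hPhi : IsPhi k H A rho n Phi) (a : Fin (n + 1) → A)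
    (g : Fin (n + 1) → H) (R : ∀ i : Fin (n + 1), IterRepr k H ((i : ℕ) + 1) (g i)) :
    Phi (tpow k (A ⊗[k] H) n fun i => a i ⊗ₜ[k] g i) =
      ∑ e ∈ Fintype.piFinset fun i => (R i).s,
        tpow k H n (fun i => (R i).leg (e i) (Fin.last ((i : ℕ) + 1))) ⊗ₜ[k]
        tpow k A n fun i => rho (HopfAlgebra.antipode k
          (diagProd (table fun i => (R i).leg (e i)) i 0 (n + 1 - i))) (a i) := by
  rw [hPhi a g R]
  refine Finset.sum_congr rfl fun e _ => ?_
  congr 2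
  ext i
  congr 3
  refine prod_ofFn_eq_diagProd _ _ _ _ fun m => ?_
  rw [table_eq _ (by omega) (by simp; omega)]
  simp only [zero_add]

/-- The composition `τ ∘ Φ`. -/
lemma IsCycTau.exists_apply_phi (hPhi : IsPhi k H A rho n Phi) (hTau : IsCycTau k H A rho n n Tau)
    (a : Fin (n + 1) → A) (g : Fin (n + 1) → H) :
    ∃ R : ∀ i : Fin (n + 1), IterRepr k H ((i : ℕ) + 2) (g i),
      Tau (Phi (tpow k (A ⊗[k] H) n fun i => a i ⊗ₜ[k] g i)) =
        ∑ e ∈ Fintype.piFinset fun i => (R i).s,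
          tpow k H n (fun i => (R i).leg (e i) (Fin.last ((i : ℕ) + 2))) ⊗ₜ[k]
          tpow k A n (Fin.cases
            (rho (HopfAlgebra.antipode k
                (diagProd (table fun i => (R i).leg (e i)) 0 1 (n + 1)))
              (rho (HopfAlgebra.antipode k ((R (Fin.last n)).leg (e (Fin.last n)) 0))
                (a (Fin.last n))))
            fun c : Fin n => rho (HopfAlgebra.antipode k
              (diagProd (table fun i => (R i).leg (e i)) c 0 (n + 1 - c))) (a c.castSucc)) := by
  let R (i : Fin (n + 1)) : IterRepr k H ((i : ℕ) + 1) (g i) := .arbitrary _ _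
  let Q (i : Fin (n + 1)) (x : (R i).ι) : IterRepr k H 1 ((R i).leg x (Fin.last ((i : ℕ) + 1))) :=
    .arbitrary _ _
  refine ⟨fun i => (R i).splitLast (Q i), ?_⟩
  refine Eq.trans ?_ (sum_piFinset_sigma (fun i => (R i).s) (fun i x => (Q i x).s) _).symm
  rw [hPhi.apply_table a g R, map_sum]
  refine Finset.sum_congr rfl fun e _ => ?_
  rw [hTau _ _ fun i => Q i (e i)]
  refine Finset.sum_congr rfl fun f _ => ?_
  have hlt (i : Fin (n + 1)) (m : Fin ((i : ℕ) + 2)) (hm : m ≠ Fin.last _) :=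
    (R i).splitLast_leg_of_ne (Q i) (e i) (f i) m hm
  have htable (i m : ℕ) (hi : i < n + 1) (hm : m < i + 1) :
      table (fun i => (R i).leg (e i)) i m =
        table (fun i => ((R i).splitLast (Q i)).leg ⟨e i, f i⟩) i m := by
    rw [table_eq _ hi (by simp; omega), table_eq _ hi (by simp; omega)]
    exact (hlt ⟨i, hi⟩ ⟨m, by simp; omega⟩ (by simp [Fin.ext_iff]; omega)).symm
  congr 2
  · ext i
    exact ((R i).splitLast_leg_last _ _ _).symm
  · ext c
    induction c using Fin.cases with
    | zero =>
      simp only [Fin.cases_zero]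
      congr 3
      · refine prod_ofFn_eq_diagProd _ _ _ _ fun m => ?_
        rw [zero_add, table_eq _ m.isLt (by simp; omega)]
        refine ((R m).splitLast_leg_castSucc_last _ _ _).symm.trans (congrArg _ (Fin.ext ?_))
        simp [add_comm]
      · have h : diagProd (table fun i => (R i).leg (e i)) (Fin.last n : ℕ) 0
            (n + 1 - (Fin.last n : ℕ)) = table (fun i => (R i).leg (e i)) n 0 := by
          simp [diagProd]
        exact congrArg _ (h.trans ((table_eq _ (by omega) (by simp)).trans
          (hlt (Fin.last n) 0 (by simp [Fin.ext_iff])).symm))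
    | succ c =>
      simp only [Fin.cases_succ]
      congr 3
      refine diagProd_congr fun m hm => htable _ _ ?_ (by omega)
      simp only [Fin.val_castSucc] at hm ⊢
      omega

lemma IsModuleAlgebraAction.antipode_mul (hma : IsModuleAlgebraAction k H A rho) (h l : H) (a : A) :
    rho (HopfAlgebra.antipode k (h * l)) a =
      rho (HopfAlgebra.antipode k l) (rho (HopfAlgebra.antipode k h) a) := by
  rw [HopfAlgebra.antipode_mul_antidistrib, hma.2]

/-- The composition `Φ ∘ τ_{A #_σ H}`. -/
lemma IsPhi.apply_cons (hma : IsModuleAlgebraAction k H A rho) (hPhi : IsPhi k H A rho n Phi)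
    (a₀ : A) (g₀ : H) (a : Fin n → A) (g : Fin n → H) (Q : IterRepr k H 1 g₀)
    (R : ∀ j : Fin n, IterRepr k H ((j : ℕ) + 2) (g j)) :
    Phi (tpow k (A ⊗[k] H) n (Fin.cases (a₀ ⊗ₜ[k] g₀) fun j => a j ⊗ₜ[k] g j)) =
      ∑ e ∈ Fintype.piFinset fun j => (R j).s, ∑ y ∈ Q.s,
        tpow k H n (Fin.cons (α := fun _ => H) (Q.leg y 1)
          fun j => (R j).leg (e j) (Fin.last ((j : ℕ) + 2))) ⊗ₜ[k]
        tpow k A n (Fin.cons (α := fun _ => A)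
          (rho (HopfAlgebra.antipode k (diagProd (table fun j => (R j).leg (e j)) 0 1 n))
            (rho (HopfAlgebra.antipode k (Q.leg y 0)) a₀))
          fun c => rho (HopfAlgebra.antipode k
            (diagProd (table fun j => (R j).leg (e j)) c 0 (n - c))) (a c)) := by
  let a' : Fin (n + 1) → A := Fin.cases a₀ a
  let g' : Fin (n + 1) → H := Fin.cases g₀ g
  let R' : ∀ i : Fin (n + 1), IterRepr k H ((i : ℕ) + 1) (g' i) := Fin.cases Q R
  have hx : (Fin.cases (a₀ ⊗ₜ[k] g₀) fun j => a j ⊗ₜ[k] g j : Fin (n + 1) → A ⊗[k] H) =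
      fun i => a' i ⊗ₜ[k] g' i := by
    ext i
    induction i using Fin.cases <;> rfl
  rw [hx, hPhi.apply_table a' g' R', sum_piFinset_cons, Finset.sum_comm]
  refine Finset.sum_congr rfl fun e _ => Finset.sum_congr rfl fun y _ => ?_
  have htable (i m : ℕ) (hi : i < n) (hm : m < i + 3) :
      table (fun i => (R' i).leg (Fin.cons (α := fun i => (R' i).ι) y e i)) (i + 1) m =
        table (fun j => (R j).leg (e j)) i m := by
    rw [table_eq _ (by omega) (by simp; omega), table_eq _ hi (by simp; omega)]
    rfl
  have htable₀ : table (fun i => (R' i).leg (Fin.cons (α := fun i => (R' i).ι) y e i)) 0 0 =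
      Q.leg y 0 := table_eq _ (Nat.succ_pos n) (Nat.succ_pos 1)
  congr 2
  · ext i
    induction i using Fin.cases <;> rfl
  · ext c
    induction c using Fin.cases with
    | zero =>
      rw [Fin.cons_zero, ← hma.antipode_mul, Fin.val_zero, Nat.sub_zero, diagProd_succ', htable₀]
      congr 4
      refine diagProd_congr fun m hm => ?_
      rw [zero_add, zero_add, add_comm 1 m]
      exact htable m (m + 1) hm (by omega)
    | succ c =>
      rw [Fin.cons_succ, Fin.val_succ, Nat.add_sub_add_right]
      congr 3
      refine diagProd_congr fun m hm => ?_
      rw [add_right_comm]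
      exact htable (c + m) (0 + m) (by omega) (by omega)

end Intertwining

/-- Under the standing assumptions, `Φ` intertwines the cyclic operator
`τ_{A#_σH}` of the cyclic module of the algebra `A #_σ H` with the diagonal cyclic operator
`t ∘ τ`:  `(t ∘ τ) ∘ Φ = Φ ∘ τ_{A#_σH}`. -/
theorem phi_intertwines_cyclic
    (k : Type) [Field k] (H : Type) [Ring H] [HopfAlgebra k H]
    (A : Type) [Ring A] [Algebra k A]
    (rho : H →ₗ[k] A →ₗ[k] A) (sg : H →ₗ[k] H →ₗ[k] k)
    (hco : Cocomm k H) (hma : IsModuleAlgebraAction k H A rho)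
    (hnorm : NormalKA k H A sg) (hcoc : CocycleKA k H A sg)
    (htw : TwistedModuleK k H A rho sg) (hinv : ConvInvertibleK k H A sg)
    (n : ℕ)
    (Phi : (Tpow k (A ⊗[k] H) n : Type) →ₗ[k]
      ((Tpow k H n : Type) ⊗[k] (Tpow k A n : Type)))
    (T Tau : ((Tpow k H n : Type) ⊗[k] (Tpow k A n : Type)) →ₗ[k]
      ((Tpow k H n : Type) ⊗[k] (Tpow k A n : Type)))
    (C : (Tpow k (A ⊗[k] H) n : Type) →ₗ[k] (Tpow k (A ⊗[k] H) n : Type))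
    (hPhi : IsPhi k H A rho n Phi)
    (hT : IsCycT k H A rho n n T)
    (hTau : IsCycTau k H A rho n n Tau)
    (hC : IsAlgCyc k (A ⊗[k] H) n C) :
    (T ∘ₗ Tau) ∘ₗ Phi = Phi ∘ₗ C := by
  refine Tpow.ext_tmul fun a g => ?_
  obtain ⟨R, hR⟩ := hTau.exists_apply_phi hPhi a g
  simp only [LinearMap.comp_apply]
  let Q : IterRepr k H 1 (g (Fin.last n)) := .arbitrary _ _
  have hRHS := hPhi.apply_cons hma (a (Fin.last n)) (g (Fin.last n)) (fun j => a j.castSucc)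
    (fun j => g j.castSucc) Q fun j => R j.castSucc
  rw [hR, hC, hRHS, map_sum, sum_piFinset_snoc]
  refine Finset.sum_congr rfl fun e _ => ?_
  set ℓ := table fun j : Fin n => (R j.castSucc).leg (e j) with hℓ
  let w (l : H) : Fin (n + 1) → A := Fin.cons (α := fun _ => A)
    (rho (HopfAlgebra.antipode k (diagProd ℓ 0 1 n))
      (rho (HopfAlgebra.antipode k l) (a (Fin.last n))))
    fun c => rho (HopfAlgebra.antipode k (diagProd ℓ c 0 (n - c))) (a c.castSucc)
  let V : H →ₗ[k] (Tpow k A n : Type) :=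
    (tpowMultilinear k A n).toLinearMap (w 0) 0 ∘ₗ
      rho (HopfAlgebra.antipode k (diagProd ℓ 0 1 n)) ∘ₗ
        rho.flip (a (Fin.last n)) ∘ₗ HopfAlgebra.antipode k
  have hV (l : H) : V l = tpow k A n (w l) := by
    simp [V, w, Fin.update_cons_zero]
  refine Eq.trans (Finset.sum_congr rfl fun x _ => ?_) (hT.sum_apply hco hma
    (fun j : Fin n => (R j.castSucc).leg (e j) (Fin.last ((j : ℕ) + 2))) V w hV
    (R (Fin.last n)) Q)
  have hlast : Fin.snoc (α := fun i => (R i).ι) e x (Fin.last n) = x := Fin.snoc_last _ _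
  have hcast (j : Fin n) : Fin.snoc (α := fun i => (R i).ι) e x j.castSucc = e j :=
    Fin.snoc_castSucc _ _ _
  have htable (i m : ℕ) (hi : i < n) (hm : m < i + 3) :
      table (fun i => (R i).leg (Fin.snoc (α := fun i => (R i).ι) e x i)) i m = ℓ i m := by
    rw [hℓ, table_eq _ (by omega) hm, table_eq _ hi hm]
    exact congrArg (fun z => (R (Fin.castSucc ⟨i, hi⟩)).leg z ⟨m, hm⟩) (hcast ⟨i, hi⟩)
  have htable_last (m : ℕ) (hm : m < n + 3) :
      table (fun i => (R i).leg (Fin.snoc (α := fun i => (R i).ι) e x i)) n m =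
        (R (Fin.last n)).leg x ⟨m, hm⟩ := by
    rw [table_eq _ (by omega) hm]
    exact congrArg (fun z => (R (Fin.last n)).leg z ⟨m, hm⟩) hlast
  congr 3
  · ext i
    induction i using Fin.lastCases with
    | last => rw [hlast, Fin.snoc_last]; rfl
    | cast j => rw [hcast, Fin.snoc_castSucc]; rfl
  · ext c
    induction c using Fin.cases with
    | zero =>
      have hprod : diagProd (table fun i => (R i).leg (Fin.snoc (α := fun i => (R i).ι) e x i))
          0 1 n = diagProd ℓ 0 1 n :=
        diagProd_congr fun m hm => htable _ _ (by omega) (by omega)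
      have hval : table (fun i => (R i).leg (Fin.snoc (α := fun i => (R i).ι) e x i))
          (0 + n) (1 + n) = (R (Fin.last n)).leg x (Fin.rev (0 : Fin (n + 1))).castSucc.succ := by
        rw [zero_add, htable_last _ (by omega)]
        congr 1
        ext
        simp [add_comm]
      simp only [Fin.cases_zero, w, Fin.cons_zero]
      rw [diagProd_succ, hprod, hval, hma.antipode_mul, hlast]
    | succ c =>
      have hprod : diagProd (table fun i => (R i).leg (Fin.snoc (α := fun i => (R i).ι) e x i))
          c 0 (n - c) = diagProd ℓ c 0 (n - c) :=
        diagProd_congr fun m hm => htable _ _ (by omega) (by omega)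
      have hval : table (fun i => (R i).leg (Fin.snoc (α := fun i => (R i).ι) e x i))
          (c + (n - c)) (0 + (n - c)) =
            (R (Fin.last n)).leg x c.succ.rev.castSucc.succ := by
        rw [Nat.add_sub_of_le c.is_le', zero_add, htable_last _ (by omega)]
        congr 1
        ext
        simp [Fin.val_rev]
        omega
      simp only [Fin.cases_succ, w, Fin.cons_succ]
      rw [Nat.sub_add_comm c.is_le', diagProd_succ, hprod, hval, hma.antipode_mul]
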